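/- Let q be a 2way-determined query, κ = l^l and k = 2^{2κ+1} + κ − 1. For every database D that contains no tripath of q: D ⊨ certain(q) if and only if ∅ ∈ Δ_k(q,D). -/

import Mathlib

/- Consistent query answering framework: a single relation symbol of arity `n`
   whose first `l` positions form the primary key. Facts are `Fin n → Elem`,
   atoms are `Fin n → Var`. -/

namespace CQA

/-- Key-equality: the tuples of the first `l` entries coincide. -/
def keyEq (l : ℕ) {n : ℕ} {α : Type*} (s t : Fin n → α) : Prop :=
  ∀ i : Fin n, (i : ℕ) < l → s i = t i

/-- The set of entries occurring in the first `l` (key) positions of a tuple. -/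
def keySet (l : ℕ) {n : ℕ} {α : Type*} (t : Fin n → α) : Set α :=
  {x | ∃ i : Fin n, (i : ℕ) < l ∧ t i = x}

/-- The set of all entries of a tuple. -/
def varsSet {n : ℕ} {α : Type*} (t : Fin n → α) : Set α :=
  Set.range t

/-- A (two-atom, Boolean, self-join) query `q = AB` is a pair of atoms. -/
abbrev Query (n : ℕ) (Var : Type*) := (Fin n → Var) × (Fin n → Var)

variable {n : ℕ} {Elem Var : Type*}

/-- The pair of facts `(a, b)` matches the two atoms of `q` via a single assignment `μ`. -/
def solPair (q : Query n Var) (a b : Fin n → Elem) : Prop :=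
  ∃ μ : Var → Elem, (∀ i, μ (q.1 i) = a i) ∧ (∀ i, μ (q.2 i) = b i)

/-- `D ⊨ q(ab)` : `(a,b)` is a solution to `q` in `D`. -/
def Sol (q : Query n Var) (D : Set (Fin n → Elem)) (a b : Fin n → Elem) : Prop :=
  a ∈ D ∧ b ∈ D ∧ solPair q a b

/-- `D ⊨ q{ab}` : `(a,b)` or `(b,a)` is a solution to `q` in `D`. -/
def SolSym (q : Query n Var) (D : Set (Fin n → Elem)) (a b : Fin n → Elem) : Prop :=
  Sol q D a b ∨ Sol q D b a

/-- The set `q(D)` of solutions to `q` in `D`. -/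
def solSet (q : Query n Var) (D : Set (Fin n → Elem)) :
    Set ((Fin n → Elem) × (Fin n → Elem)) :=
  {p | Sol q D p.1 p.2}

/-- `D ⊨ q` : some solution to `q` exists in `D`. -/
def Sat (q : Query n Var) (D : Set (Fin n → Elem)) : Prop :=
  ∃ a b, Sol q D a b

/-- A database is consistent if it contains no two distinct key-equal facts. -/
def Consistent (l : ℕ) (D : Set (Fin n → Elem)) : Prop :=
  ∀ a ∈ D, ∀ b ∈ D, keyEq l a b → a = b

/-- `r` is a repair of `D` : a maximal consistent subset of `D`. -/
def Repair (l : ℕ) (D r : Set (Fin n → Elem)) : Prop :=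
  r ⊆ D ∧ Consistent l r ∧ ∀ s, r ⊆ s → s ⊆ D → Consistent l s → s = r

/-- `D ⊨ certain(q)` : all repairs of `D` satisfy `q`. -/
def Certain (l : ℕ) (q : Query n Var) (D : Set (Fin n → Elem)) : Prop :=
  ∀ r, Repair l D r → Sat q r

/-- The block of the fact `a` in `D`: all facts of `D` key-equal to `a`. -/
def Block (l : ℕ) (D : Set (Fin n → Elem)) (a : Fin n → Elem) : Set (Fin n → Elem) :=
  {b ∈ D | keyEq l a b}

/-- A `k`-set of `D`: at most `k` facts of `D`, at most one from each block. -/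
def kSet (l k : ℕ) (D S : Set (Fin n → Elem)) : Prop :=
  S ⊆ D ∧ S.Finite ∧ S.ncard ≤ k ∧ Consistent l S

/-- A collection `𝒮` of sets of facts is closed under the two rules defining `Δ_k(q,D)`:
  (i) every `k`-set satisfying `q` is in `𝒮`, and (ii) if for a `k`-set `S` there is
  a block of `D` each of whose facts `u` admits a subset `S' ⊆ S ∪ {u}` that is a
  `k`-set belonging to `𝒮`, then `S ∈ 𝒮`. -/
def DeltaClosed (l k : ℕ) (q : Query n Var) (D : Set (Fin n → Elem))
    (𝒮 : Set (Set (Fin n → Elem))) : Prop :=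
  (∀ S, kSet l k D S → Sat q S → S ∈ 𝒮) ∧
  (∀ S, kSet l k D S → (∃ x ∈ D, ∀ u ∈ D, keyEq l x u →
      ∃ S', S' ⊆ S ∪ {u} ∧ kSet l k D S' ∧ S' ∈ 𝒮) → S ∈ 𝒮)

/-- `Δ_k(q,D)`: the least collection of `k`-sets of `D` closed under the two rules
(the intersection of all closed collections). -/
def Delta (l k : ℕ) (q : Query n Var) (D : Set (Fin n → Elem)) :
    Set (Set (Fin n → Elem)) :=
  ⋂₀ {𝒮 | DeltaClosed l k q D 𝒮}

/-- `q = AB` is 2way-determined. -/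
def TwoWayDet (l : ℕ) (q : Query n Var) : Prop :=
  ¬ keySet l q.1 ⊆ keySet l q.2 ∧ ¬ keySet l q.2 ⊆ keySet l q.1 ∧
  keySet l q.1 ⊆ varsSet q.2 ∧ keySet l q.2 ⊆ varsSet q.1

/-- The zig-zag property of a query `q`, relative to databases over `Elem`. -/
def ZigZag (l : ℕ) (q : Query n Var) (Elem : Type*) : Prop :=
  ∀ D : Set (Fin n → Elem), D.Finite →
    ∀ a b b' c : Fin n → Elem, a ∈ D → b ∈ D → b' ∈ D → c ∈ D →
      ¬ keyEq l a c → a ≠ b → keyEq l b b' →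
      Sol q D a b → Sol q D c b' → Sol q D a b'

/-- `rkey(a, r)`: facts of `r` whose key entries are included in those of `a`. -/
def rkey (l : ℕ) (r : Set (Fin n → Elem)) (a : Fin n → Elem) : Set (Fin n → Elem) :=
  {c ∈ r | keySet l c ⊆ keySet l a}

open Classical in
/-- `g(e)`, the set of entries of the tuple `g̅(e)`, for `e` branching with `d, f`. -/
noncomputable def gSet (l : ℕ) (d e f : Fin n → Elem) : Set Elem :=
  if keySet l d ⊆ keySet l e ∧ ¬ keySet l f ⊆ keySet l e then keySet l d
  else if ¬ keySet l d ⊆ keySet l e ∧ keySet l f ⊆ keySet l e then keySet l f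
  else if keySet l d ⊆ keySet l f ∧ keySet l f ⊆ keySet l e then keySet l d
  else if keySet l f ⊆ keySet l d ∧ keySet l d ⊆ keySet l e then keySet l f
  else keySet l e

/-- A tripath of `q`: a database `Θ`, each of whose blocks has at most two facts,
whose blocks (indexed by `Fin m`) are arranged as a rooted tree with exactly one root
block and exactly two leaf blocks; the root block has the single fact `a(root)`, leaf
blocks have the single fact `b(leaf)`, all other blocks have exactly the two facts
`a(B) ≠ b(B)`; if `B` is the parent of `B'` then `Θ ⊨ q{a(B) b(B')}`; the (unique)
branching block `B` with its two children `B', B''` gives the center `d e f` =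
`b(B') a(B) b(B'')` with `(d,e)` and `(e,f)` distinct solutions; and `g(e)` is not
included in the key of the root fact nor of either leaf fact. -/
structure Tripath (l : ℕ) (q : Query n Var) (Θ : Set (Fin n → Elem)) where
  finite : Θ.Finite
  m : ℕ
  blk : Fin m → Set (Fin n → Elem)
  blk_is_block : ∀ i, ∃ x ∈ Θ, blk i = Block l Θ x
  blk_cover : Θ = ⋃ i, blk i
  blk_inj : Function.Injective blk
  blk_card : ∀ i, (blk i).ncard ≤ 2
  parent : Fin m → Option (Fin m)
  root : Fin m
  parent_root : parent root = none
  parent_ne_root : ∀ i, i ≠ root → ∃ j, parent i = some j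
  reach_root : ∀ i, Relation.ReflTransGen (fun x y => parent x = some y) i root
  leaf1 : Fin m
  leaf2 : Fin m
  leaf_ne : leaf1 ≠ leaf2
  leaf1_leaf : ∀ j, parent j ≠ some leaf1
  leaf2_leaf : ∀ j, parent j ≠ some leaf2
  leaves_eq : ∀ i, (∀ j, parent j ≠ some i) → i = leaf1 ∨ i = leaf2
  aFact : Fin m → (Fin n → Elem)
  bFact : Fin m → (Fin n → Elem)
  root_blk : blk root = {aFact root}
  leaf1_blk : blk leaf1 = {bFact leaf1}
  leaf2_blk : blk leaf2 = {bFact leaf2}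
  other_blk : ∀ i, i ≠ root → i ≠ leaf1 → i ≠ leaf2 →
    aFact i ≠ bFact i ∧ blk i = {aFact i, bFact i}
  adj_sol : ∀ i j, parent j = some i → SolSym q Θ (aFact i) (bFact j)
  branch : Fin m
  child1 : Fin m
  child2 : Fin m
  child_ne : child1 ≠ child2
  parent_child1 : parent child1 = some branch
  parent_child2 : parent child2 = some branch
  center_sol1 : Sol q Θ (bFact child1) (aFact branch)
  center_sol2 : Sol q Θ (aFact branch) (bFact child2)
  center_distinct : (bFact child1, aFact branch) ≠ (aFact branch, bFact child2)
  g_root : ¬ gSet l (bFact child1) (aFact branch) (bFact child2) ⊆ keySet l (aFact root)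
  g_leaf1 : ¬ gSet l (bFact child1) (aFact branch) (bFact child2) ⊆ keySet l (bFact leaf1)
  g_leaf2 : ¬ gSet l (bFact child1) (aFact branch) (bFact child2) ⊆ keySet l (bFact leaf2)

namespace Tripath

variable {l : ℕ} {q : Query n Var} {Θ : Set (Fin n → Elem)}

/-- The fact `d` of the center `def` of a tripath. -/
def dc (T : Tripath l q Θ) : Fin n → Elem := T.bFact T.child1
/-- The fact `e` of the center `def` of a tripath. -/
def ec (T : Tripath l q Θ) : Fin n → Elem := T.aFact T.branch
/-- The fact `f` of the center `def` of a tripath. -/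
def fc (T : Tripath l q Θ) : Fin n → Elem := T.bFact T.child2
/-- The root fact `u₀` of a tripath. -/
def u0 (T : Tripath l q Θ) : Fin n → Elem := T.aFact T.root
/-- The leaf fact `u₁` of a tripath. -/
def u1 (T : Tripath l q Θ) : Fin n → Elem := T.bFact T.leaf1
/-- The leaf fact `u₂` of a tripath. -/
def u2 (T : Tripath l q Θ) : Fin n → Elem := T.bFact T.leaf2

/-- The center of the tripath is a fork (`(f,d)` is not a solution). -/
def IsFork (T : Tripath l q Θ) : Prop := ¬ Sol q Θ T.fc T.dc

/-- The center of the tripath is a triangle (`(f,d)` is a solution). -/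
def IsTriangle (T : Tripath l q Θ) : Prop := Sol q Θ T.fc T.dc

/-- Variable-niceness witnessed by the elements `x, y, z`. -/
def VariableNiceWith (T : Tripath l q Θ) (x y z : Elem) : Prop :=
  x ∈ keySet l T.dc ∧ y ∈ keySet l T.ec ∧ z ∈ keySet l T.fc ∧
  ({x, y, z} : Set Elem) ∩ (keySet l T.u0 ∪ keySet l T.u1 ∪ keySet l T.u2) = ∅

/-- The tripath is variable-nice. -/
def VariableNice (T : Tripath l q Θ) : Prop := ∃ x y z, T.VariableNiceWith x y z

/-- The tripath is solution-nice: the only solutions to `q` in `Θ` are those between a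
parent block and a child block, plus possibly `(f, d)`. -/
def SolutionNice (T : Tripath l q Θ) : Prop :=
  ∀ a b, Sol q Θ a b →
    (∃ i j, T.parent j = some i ∧
      ((a = T.aFact i ∧ b = T.bFact j) ∨ (a = T.bFact j ∧ b = T.aFact i)))
    ∨ (a = T.fc ∧ b = T.dc)

/-- The tripath is nice. -/
def Nice (T : Tripath l q Θ) : Prop :=
  (∃ x y z : Elem, T.VariableNiceWith x y z ∧
    ∃ w ∈ ({x, y, z} : Set Elem),
      ∀ c ∈ Θ, c ≠ T.u0 → c ≠ T.u1 → c ≠ T.u2 → w ∈ keySet l c) ∧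
  T.SolutionNice ∧
  (∀ u ∈ ({T.u0, T.u1, T.u2} : Set (Fin n → Elem)),
    ∃ w ∈ keySet l u, ∀ c ∈ Θ, c ≠ u → w ∉ keySet l c)

end Tripath

/-- `D` contains a tripath of `q`: some subset of `D` is a tripath of `q`. -/
def ContainsTripath (l : ℕ) (q : Query n Var) (D : Set (Fin n → Elem)) : Prop :=
  ∃ Θ ⊆ D, Nonempty (Tripath l q Θ)

/-- `q` admits a fork-tripath (over databases with elements in `Elem`). -/
def AdmitsForkTripath (l : ℕ) (q : Query n Var) (Elem : Type*) : Prop :=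
  ∃ D : Set (Fin n → Elem), D.Finite ∧ ∃ Θ ⊆ D, ∃ T : Tripath l q Θ, T.IsFork

/-- `q` admits a triangle-tripath (over databases with elements in `Elem`). -/
def AdmitsTriangleTripath (l : ℕ) (q : Query n Var) (Elem : Type*) : Prop :=
  ∃ D : Set (Fin n → Elem), D.Finite ∧ ∃ Θ ⊆ D, ∃ T : Tripath l q Θ, T.IsTriangle

/-- `q` admits a tripath (over databases with elements in `Elem`). -/
def AdmitsTripath (l : ℕ) (q : Query n Var) (Elem : Type*) : Prop :=
  ∃ D : Set (Fin n → Elem), D.Finite ∧ ContainsTripath l q D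

/-- Edges of the solution graph `G(D,q)`: distinct facts `a, b` of `D` with `D ⊨ q{ab}`. -/
def gEdge (q : Query n Var) (D : Set (Fin n → Elem)) (a b : Fin n → Elem) : Prop :=
  a ≠ b ∧ a ∈ D ∧ b ∈ D ∧ SolSym q D a b

/-- The connected component of the fact `a` in the solution graph `G(D,q)`. -/
def gComp (q : Query n Var) (D : Set (Fin n → Elem)) (a : Fin n → Elem) :
    Set (Fin n → Elem) :=
  {b ∈ D | Relation.ReflTransGen (gEdge q D) a b}

/-- `C` is a quasi-clique (of the solution graph of `D`): any two non-key-equal facts of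
`C` are joined by an edge. -/
def QuasiClique (l : ℕ) (q : Query n Var) (D : Set (Fin n → Elem))
    (C : Set (Fin n → Elem)) : Prop :=
  ∀ a ∈ C, ∀ b ∈ C, ¬ keyEq l a b → SolSym q D a b

open Classical in
/-- `clique(a)`: the connected component of `a` in `G(D,q)` if it is a quasi-clique, and
`{a}` otherwise. -/
noncomputable def cliqueOf (l : ℕ) (q : Query n Var) (D : Set (Fin n → Elem))
    (a : Fin n → Elem) : Set (Fin n → Elem) :=
  if QuasiClique l q D (gComp q D a) then gComp q D a else {a}

/-- Edges of the bipartite graph `H(D,q)`: between a block `B` of `D` and a set `c` of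
the form `clique(y)`, when `B` contains a fact `a ∈ c` with `(a,a)` not a solution. -/
def HEdge (l : ℕ) (q : Query n Var) (D : Set (Fin n → Elem))
    (B c : Set (Fin n → Elem)) : Prop :=
  (∃ x ∈ D, B = Block l D x) ∧ (∃ y ∈ D, c = cliqueOf l q D y) ∧
  ∃ a ∈ B, a ∈ c ∧ ¬ Sol q D a a

/-- `H(D,q)` admits a matching saturating the set `V₁` of blocks of `D`: an injective
assignment of an `H`-edge to every block. -/
def SaturatingMatching (l : ℕ) (q : Query n Var) (D : Set (Fin n → Elem)) : Prop :=
  ∃ M : Set (Fin n → Elem) → Set (Fin n → Elem),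
    (∀ x ∈ D, HEdge l q D (Block l D x) (M (Block l D x))) ∧
    (∀ x ∈ D, ∀ y ∈ D, M (Block l D x) = M (Block l D y) → Block l D x = Block l D y)

/-- `D` is a clique-database for `q`: every connected component of `G(D,q)` is a
quasi-clique. -/
def CliqueDB (l : ℕ) (q : Query n Var) (D : Set (Fin n → Elem)) : Prop :=
  ∀ a ∈ D, QuasiClique l q D (gComp q D a)

/-- `q` is a clique-query: every database (over `Elem`) is a clique-database for `q`. -/
def CliqueQuery (l : ℕ) (q : Query n Var) (Elem : Type*) : Prop :=
  ∀ D : Set (Fin n → Elem), D.Finite → CliqueDB l q D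

/-- One step of `q`-connectedness between (the blocks of) two facts of `D`:
either they are in the same block, or some fact of the block of `x` and some fact
of the block of `y` form a solution. -/
def qConnRel (l : ℕ) (q : Query n Var) (D : Set (Fin n → Elem))
    (x y : Fin n → Elem) : Prop :=
  keyEq l x y ∨ ∃ a b, a ∈ Block l D x ∧ b ∈ Block l D y ∧ SolSym q D a b

/-- The blocks of `x` and of `y` are `q`-connected in `D`
(reflexive-symmetric-transitive closure). -/
def qConn (l : ℕ) (q : Query n Var) (D : Set (Fin n → Elem))
    (x y : Fin n → Elem) : Prop :=
  Relation.EqvGen (qConnRel l q D) x y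

/-- The `q`-connected component of (the block of) the fact `x` in `D`. -/
def qComponent (l : ℕ) (q : Query n Var) (D : Set (Fin n → Elem))
    (x : Fin n → Elem) : Set (Fin n → Elem) :=
  {y ∈ D | qConn l q D x y}

end CQA

namespace CQA

section Aux

variable {n l k : ℕ} {Elem Var : Type} {q : Query n Var} {D : Set (Fin n → Elem)}

theorem kE_refl {α : Type} (a : Fin n → α) : keyEq l a a := fun _ _ => rfl
theorem kE_symm {α : Type} {a b : Fin n → α} (h : keyEq l a b) : keyEq l b a :=
  fun i hi => (h i hi).symm
theorem kE_trans {α : Type} {a b c : Fin n → α} (h : keyEq l a b) (h2 : keyEq l b c) :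
    keyEq l a c := fun i hi => (h i hi).trans (h2 i hi)
theorem kS_eq {α : Type} {a b : Fin n → α} (h : keyEq l a b) : keySet l a = keySet l b := by
  ext x
  constructor
  · rintro ⟨i, hi, rfl⟩
    exact ⟨i, hi, (h i hi).symm⟩
  · rintro ⟨i, hi, rfl⟩
    exact ⟨i, hi, (h i hi)⟩

def link (q : Query n Var) (a b : Fin n → Elem) : Prop := solPair q a b ∨ solPair q b a

theorem link_symm {a b : Fin n → Elem} (h : link q a b) : link q b a := h.symm

theorem det1 (hq : TwoWayDet l q) {a b c : Fin n → Elem} (h1 : solPair q a b)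
    (h2 : solPair q c b) : keyEq l a c := by
  obtain ⟨μ, ha, hb⟩ := h1
  obtain ⟨ν, ha', hb'⟩ := h2
  intro i hi
  obtain ⟨j, hj⟩ := hq.2.2.1 ⟨i, hi, rfl⟩
  rw [← ha, ← ha', ← hj, hb, hb']

theorem det2 (hq : TwoWayDet l q) {a b c : Fin n → Elem} (h1 : solPair q a b)
    (h2 : solPair q a c) : keyEq l b c := by
  obtain ⟨μ, ha, hb⟩ := h1
  obtain ⟨ν, ha', hb'⟩ := h2
  intro i hi
  obtain ⟨j, hj⟩ := hq.2.2.2 ⟨i, hi, rfl⟩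
  rw [← hb, ← hb', ← hj, ha, ha']

theorem orient (hq : TwoWayDet l q) {e y f : Fin n → Elem} (h1 : link q e y) (h2 : link q e f)
    (h : ¬ keyEq l y f) :
    (solPair q y e ∧ solPair q e f) ∨ (solPair q f e ∧ solPair q e y) := by
  rcases h1 with h1 | h1 <;> rcases h2 with h2 | h2
  · exact absurd (det2 hq h1 h2) h
  · exact Or.inr ⟨h2, h1⟩
  · exact Or.inl ⟨h1, h2⟩
  · exact absurd (det1 hq h1 h2) h

theorem nbr_two (hq : TwoWayDet l q) {e y f z : Fin n → Elem} (h1 : link q e y)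
    (h2 : link q e f) (h : ¬ keyEq l y f) (h3 : link q e z) : keyEq l y z ∨ keyEq l f z := by
  rcases orient hq h1 h2 h with ⟨h4, h5⟩ | ⟨h4, h5⟩ <;> rcases h3 with h3 | h3
  · exact Or.inr (det2 hq h5 h3)
  · exact Or.inl (det1 hq h4 h3)
  · exact Or.inl (det2 hq h5 h3)
  · exact Or.inr (det1 hq h4 h3)

theorem gSet_sub (d e f : Fin n → Elem) : gSet l d e f ⊆ keySet l e := by
  unfold gSet
  split_ifs with h1 h2 h3 h4
  · exact h1.1
  · exact h2.2
  · exact h3.1.trans h3.2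
  · exact h4.1.trans h4.2
  · exact subset_rfl

theorem gSet_cases (d e f : Fin n → Elem) :
    gSet l d e f = keySet l d ∨ gSet l d e f = keySet l e ∨ gSet l d e f = keySet l f := by
  unfold gSet
  split_ifs <;> simp

theorem gSet_symm (d e f : Fin n → Elem) : gSet l d e f = gSet l f e d := by
  unfold gSet
  by_cases h1 : keySet l d ⊆ keySet l e <;> by_cases h2 : keySet l f ⊆ keySet l e <;>
  by_cases h3 : keySet l d ⊆ keySet l f <;> by_cases h4 : keySet l f ⊆ keySet l d <;>
  simp [h1, h2, h3, h4]
  exact h3.antisymm h4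

theorem count_le (hl : l ≤ n) {ι : Type} (J : Finset ι) (c : ι → (Fin n → Elem))
    (w : Fin n → Elem) (h1 : ∀ j ∈ J, keySet l (c j) ⊆ keySet l w)
    (h2 : ∀ j ∈ J, ∀ j' ∈ J, keyEq l (c j) (c j') → j = j') : J.card ≤ l ^ l := by
  classical
  have h : ∀ j, ∃ σ : Fin l → Fin l, j ∈ J → ∀ i : Fin l,
      c j (Fin.castLE hl i) = w (Fin.castLE hl (σ i)) := by
    intro j
    by_cases hj : j ∈ J
    · have : ∀ i : Fin l, ∃ i' : Fin l, c j (Fin.castLE hl i) = w (Fin.castLE hl i') := by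
        intro i
        obtain ⟨i', hi', h⟩ := h1 j hj ⟨Fin.castLE hl i, by simp, rfl⟩
        exact ⟨⟨i', hi'⟩, h.symm⟩
      choose σ hσ using this
      exact ⟨σ, fun _ => hσ⟩
    · exact ⟨id, fun h => absurd h hj⟩
  choose σ hσ using h
  have : J.card ≤ (Finset.univ : Finset (Fin l → Fin l)).card := by
    apply Finset.card_le_card_of_injOn σ (fun _ _ => by simp)
    intro j hj j' hj' he
    apply h2 j hj j' hj'
    intro i hi
    have e1 := hσ j hj ⟨i, hi⟩
    have e2 := hσ j' hj' ⟨i, hi⟩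
    rw [he] at e1
    exact e1.trans e2.symm
  simpa using this

theorem delta_closed : DeltaClosed l k q D (Delta l k q D) := by
  constructor
  · intro S h1 h2 𝒮 h𝒮
    exact h𝒮.1 S h1 h2
  · rintro S h1 ⟨x, hx, h⟩ 𝒮 h𝒮
    refine h𝒮.2 S h1 ⟨x, hx, fun u hu hxu => ?_⟩
    obtain ⟨S', h3, h4, h5⟩ := h u hu hxu
    exact ⟨S', h3, h4, h5 𝒮 h𝒮⟩

def Live (l k : ℕ) (q : Query n Var) (D S : Set (Fin n → Elem)) : Prop :=
  kSet l k D S ∧ S ∉ Delta l k q D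

theorem kSet_mono {S S' : Set (Fin n → Elem)} (h : kSet l k D S) (hs : S' ⊆ S) :
    kSet l k D S' :=
  ⟨hs.trans h.1, h.2.1.subset hs, (Set.ncard_le_ncard hs h.2.1).trans h.2.2.1,
    fun a ha b hb => h.2.2.2 a (hs ha) b (hs hb)⟩

theorem live_mono (hD : D.Nonempty) {S S' : Set (Fin n → Elem)} (h : Live l k q D S)
    (hs : S' ⊆ S) : Live l k q D S' := by
  refine ⟨kSet_mono h.1 hs, fun h' => h.2 ?_⟩
  obtain ⟨x, hx⟩ := hD
  exact delta_closed.2 S h.1 ⟨x, hx, fun u _ _ =>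
    ⟨S', hs.trans Set.subset_union_left, kSet_mono h.1 hs, h'⟩⟩

theorem live_nolink {S : Set (Fin n → Elem)} (h : Live l k q D S) {a b : Fin n → Elem}
    (ha : a ∈ S) (hb : b ∈ S) : ¬ link q a b := by
  rintro (h' | h')
  · exact h.2 (delta_closed.1 S h.1 ⟨a, b, ha, hb, h'⟩)
  · exact h.2 (delta_closed.1 S h.1 ⟨b, a, hb, ha, h'⟩)

theorem live_extend {S : Set (Fin n → Elem)} (h : Live l k q D S) {x : Fin n → Elem}
    (hx : x ∈ D) (hS : ∀ s ∈ S, ¬ keyEq l s x) (hc : S.ncard + 1 ≤ k) :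
    ∃ u ∈ D, keyEq l x u ∧ Live l k q D (insert u S) := by
  by_contra hcon
  push Not at hcon
  refine h.2 (delta_closed.2 S h.1 ⟨x, hx, fun u hu hxu => ?_⟩)
  have hk : kSet l k D (insert u S) := by
    refine ⟨Set.insert_subset hu h.1.1, h.1.2.1.insert u,
      (Set.ncard_insert_le u S).trans hc, ?_⟩
    rintro a (rfl | ha) b (rfl | hb) hab
    · rfl
    · exact absurd (kE_symm (kE_trans hxu hab)) (hS b hb)
    · exact absurd (kE_trans hab (kE_symm hxu)) (hS a ha)
    · exact h.1.2.2.2 a ha b hb hab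
  refine ⟨insert u S, by rw [Set.union_singleton], hk, ?_⟩
  by_contra h'
  exact hcon u hu hxu ⟨hk, h'⟩

theorem repair_meets {r : Set (Fin n → Elem)} (hr : Repair l D r) {x : Fin n → Elem}
    (hx : x ∈ D) : ∃ u ∈ r, keyEq l x u := by
  by_contra hcon
  push Not at hcon
  have := hr.2.2 (insert x r) (Set.subset_insert _ _) (Set.insert_subset hx hr.1) (by
    rintro a (rfl | ha) b (rfl | hb) hab
    · rfl
    · exact absurd hab (hcon b hb)
    · exact absurd (kE_symm hab) (hcon a ha)
    · exact hr.2.1 a ha b hb hab)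
  exact hcon x (this ▸ Set.mem_insert x r) (kE_refl x)

theorem sound (h : ∅ ∈ Delta l k q D) : Certain l q D := by
  have := h {S | ∀ r, Repair l D r → S ⊆ r → Sat q r} (by
    constructor
    · rintro S _ ⟨a, b, ha, hb, h⟩ r _ hS
      exact ⟨a, b, hS ha, hS hb, h⟩
    · rintro S _ ⟨x, hx, h⟩ r hr hS
      obtain ⟨u, hu, hxu⟩ := repair_meets hr hx
      obtain ⟨S', h1, _, h3⟩ := h u (hr.1 hu) hxu
      exact h3 r hr (h1.trans (Set.union_subset hS (by simpa using hu))))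
  exact fun r hr => this r hr (Set.empty_subset _)

def swapR (l : ℕ) (r W : Set (Fin n → Elem)) : Set (Fin n → Elem) :=
  W ∪ {c ∈ r | ∀ w ∈ W, ¬ keyEq l w c}

theorem swapR_repair {r W : Set (Fin n → Elem)} (hr : Repair l D r) (hW : W ⊆ D)
    (hc : Consistent l W) : Repair l D (swapR l r W) := by
  have hcon : Consistent l (swapR l r W) := by
    rintro a (ha | ha) b (hb | hb) hab
    · exact hc a ha b hb hab
    · exact absurd hab (hb.2 a ha)
    · exact absurd (kE_symm hab) (ha.2 b hb)
    · exact hr.2.1 a ha.1 b hb.1 hab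
  refine ⟨Set.union_subset hW fun c hc => hr.1 hc.1, hcon, fun s hs hsD hscon => ?_⟩
  refine Set.Subset.antisymm (fun c hcs => ?_) hs
  by_cases h : ∃ w ∈ W, keyEq l w c
  · obtain ⟨w, hw, hwc⟩ := h
    have := hscon w (hs (Or.inl hw)) c hcs hwc
    exact Or.inl (this ▸ hw)
  · push Not at h
    obtain ⟨u, hu, hcu⟩ := repair_meets hr (hsD hcs)
    have hu' : u ∈ swapR l r W :=
      Or.inr ⟨hu, fun w hw hwu => h w hw (kE_trans hwu (kE_symm hcu))⟩
    exact hscon c hcs u (hs hu') hcu ▸ hu'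

def MinR (l : ℕ) (q : Query n Var) (D W r : Set (Fin n → Elem)) : Prop :=
  Repair l D r ∧ W ⊆ r ∧
    ∀ r', Repair l D r' → W ⊆ r' → solSet q r' ⊆ solSet q r → solSet q r ⊆ solSet q r'

theorem min_below (hD : D.Finite) {W r : Set (Fin n → Elem)} (hr : Repair l D r)
    (hW : W ⊆ r) : ∃ r', MinR l q D W r' ∧ solSet q r' ⊆ solSet q r := by
  have hfin : ∀ r, Repair l D r → (solSet q r).Finite := fun r hr =>
    (hD.prod hD).subset fun p hp => ⟨hr.1 hp.1, hr.1 hp.2.1⟩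
  induction hN : (solSet q r).ncard using Nat.strong_induction_on generalizing r with
  | _ N ih =>
    by_cases hm : MinR l q D W r
    · exact ⟨r, hm, subset_rfl⟩
    · have : ∃ r', Repair l D r' ∧ W ⊆ r' ∧ solSet q r' ⊆ solSet q r ∧
          ¬ solSet q r ⊆ solSet q r' := by
        by_contra hcon
        push Not at hcon
        exact hm ⟨hr, hW, hcon⟩
      obtain ⟨r', h1, h2, h3, h4⟩ := this
      obtain ⟨r2, h5, h6⟩ := ih _ (hN ▸ Set.ncard_lt_ncard ⟨h3, h4⟩ (hfin r hr)) h1 h2 rfl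
      exact ⟨r2, h5, h6.trans h3⟩

/-- general swap step -/
theorem min_step (hD : D.Finite) {V W r : Set (Fin n → Elem)} (hr : MinR l q D V r)
    (hW : W ⊆ D) (hc : Consistent l W) (hVW : ∀ v ∈ V, ∀ w ∈ W, keyEq l w v → v = w) :
    ∃ r', MinR l q D (V ∪ W) r' ∧
      ((∃ w ∈ W, ∃ y ∈ r', link q w y) ∨ solSet q r' = solSet q r) := by
  have h1 := swapR_repair hr.1 hW hc
  have h2 : V ∪ W ⊆ swapR l r W := by
    rintro c (hcV | hcW)
    · by_cases h : ∃ w ∈ W, keyEq l w c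
      · obtain ⟨w, hw, hwc⟩ := h
        exact Or.inl (hVW c hcV w hw hwc ▸ hw)
      · push Not at h
        exact Or.inr ⟨hr.2.1 hcV, h⟩
    · exact Or.inl hcW
  obtain ⟨r', h3, h4⟩ := min_below (q := q) hD h1 h2
  refine ⟨r', h3, ?_⟩
  by_cases h : ∃ w ∈ W, ∃ y ∈ r', link q w y
  · exact Or.inl h
  · right
    push Not at h
    have hsub : solSet q r' ⊆ solSet q r := by
      rintro ⟨a, b⟩ hab
      obtain ⟨ha, hb, hs⟩ := h4 hab
      obtain ⟨ha', hb', _⟩ := hab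
      rcases ha with ha | ha
      · exact absurd (Or.inl hs) (h a ha b hb')
      rcases hb with hb | hb
      · exact absurd (Or.inr hs) (h b hb a ha')
      exact ⟨ha.1, hb.1, hs⟩
    exact hsub.antisymm (hr.2.2 r' h3.1 (Set.subset_union_left.trans h3.2.1) hsub)

theorem link_of_solSet_eq {r r' : Set (Fin n → Elem)} (h : solSet q r' = solSet q r)
    {a b : Fin n → Elem} (ha : a ∈ r) (hb : b ∈ r) (hab : link q a b) : a ∈ r' ∧ b ∈ r' := by
  rcases hab with hab | hab
  · have : (a, b) ∈ solSet q r' := h ▸ ⟨ha, hb, hab⟩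
    exact ⟨this.1, this.2.1⟩
  · have : (b, a) ∈ solSet q r' := h ▸ ⟨hb, ha, hab⟩
    exact ⟨this.2.1, this.1⟩

def tB (a b : ℕ → (Fin n → Elem)) (m1 m2 t : ℕ) : Set (Fin n → Elem) :=
  {c | (c = a t ∧ t ≠ m1 ∧ t ≠ m2) ∨ (c = b t ∧ t ≠ 0)}

def tPar (s m1 m2 : ℕ) (i : Fin (m2 + 1)) : Option (Fin (m2 + 1)) :=
  if (i : ℕ) = 0 then none
  else if (i : ℕ) = m1 + 1 then some (Fin.ofNat (m2 + 1) s)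
  else some (Fin.ofNat (m2 + 1) ((i : ℕ) - 1))

theorem tPar_iff {s m1 m2 : ℕ} (h1 : s < m1) (h2 : m1 < m2) (i j : Fin (m2 + 1)) :
    tPar s m1 m2 i = some j ↔
      ((i : ℕ) = m1 + 1 ∧ (j : ℕ) = s) ∨ ((i : ℕ) ≠ m1 + 1 ∧ (i : ℕ) = j + 1) := by
  have hi := i.2
  have hj := j.2
  unfold tPar
  split_ifs with h3 h4
  · simp; omega
  · simp only [Option.some.injEq, Fin.ext_iff, Fin.ofNat]
    rw [Nat.mod_eq_of_lt (by omega)]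
    omega
  · simp only [Option.some.injEq, Fin.ext_iff, Fin.ofNat]
    rw [Nat.mod_eq_of_lt (by omega)]
    omega

theorem mk_tripath_aux (a b : ℕ → (Fin n → Elem)) (s m1 m2 : ℕ) (hs : 1 ≤ s)
    (h1 : s < m1) (h2 : m1 < m2) (haD : ∀ t ≤ m2, a t ∈ D) (hbD : ∀ t ≤ m2, b t ∈ D)
    (hab : ∀ t ≤ m2, keyEq l (a t) (b t))
    (hne : ∀ t ≤ m2, t ≠ 0 → t ≠ m1 → t ≠ m2 → a t ≠ b t)
    (hdist : ∀ t t', t < t' → t' ≤ m2 → ¬ keyEq l (a t) (a t'))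
    (hlink : ∀ t, t + 1 ≤ m2 → t ≠ m1 → link q (a t) (b (t + 1)))
    (hlink2 : link q (a s) (b (m1 + 1))) (c1 c2 : ℕ)
    (hc : (c1 = s + 1 ∧ c2 = m1 + 1) ∨ (c1 = m1 + 1 ∧ c2 = s + 1))
    (hs1 : solPair q (b c1) (a s)) (hs2 : solPair q (a s) (b c2))
    (g0 : ¬ gSet l (b c1) (a s) (b c2) ⊆ keySet l (a 0))
    (g1 : ¬ gSet l (b c1) (a s) (b c2) ⊆ keySet l (b m1))
    (g2 : ¬ gSet l (b c1) (a s) (b c2) ⊆ keySet l (b m2)) : ContainsTripath l q D := by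
  have hkB : ∀ t ≤ m2, ∀ c ∈ tB a b m1 m2 t, keyEq l (a t) c := by
    rintro t ht c (⟨rfl, _⟩ | ⟨rfl, _⟩)
    · exact kE_refl _
    · exact hab t ht
  have hBB : ∀ t ≤ m2, ∀ t' ≤ m2, ∀ c ∈ tB a b m1 m2 t, ∀ c' ∈ tB a b m1 m2 t',
      keyEq l c c' → t = t' := by
    intro t ht t' ht' c hc c' hc' hcc
    have h3 : keyEq l (a t) (a t') :=
      kE_trans (kE_trans (hkB t ht c hc) hcc) (kE_symm (hkB t' ht' c' hc'))
    rcases lt_trichotomy t t' with h | h | h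
    · exact absurd h3 (hdist t t' h ht')
    · exact h
    · exact absurd (kE_symm h3) (hdist t' t h ht)
  have haB : ∀ t, t ≠ m1 → t ≠ m2 → a t ∈ tB a b m1 m2 t := fun t h h' => Or.inl ⟨rfl, h, h'⟩
  have hbB : ∀ t, t ≠ 0 → b t ∈ tB a b m1 m2 t := fun t h => Or.inr ⟨rfl, h⟩
  have hnon : ∀ t, ∃ c, c ∈ tB a b m1 m2 t := by
    intro t
    by_cases h : t = 0
    · exact ⟨a t, haB t (by omega) (by omega)⟩
    · exact ⟨b t, hbB t h⟩
  let Θ : Set (Fin n → Elem) := ⋃ i : Fin (m2 + 1), tB a b m1 m2 i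
  have hΘ : ∀ c t, t ≤ m2 → c ∈ tB a b m1 m2 t → c ∈ Θ := fun c t ht hc =>
    Set.mem_iUnion.2 ⟨⟨t, by omega⟩, hc⟩
  have hsub2 : ∀ t, tB a b m1 m2 t ⊆ {a t, b t} := by
    rintro t c (⟨rfl, _⟩ | ⟨rfl, _⟩) <;> simp
  have hSolSym : ∀ t t', t ≤ m2 → t' ≤ m2 → t ≠ m1 → t ≠ m2 → t' ≠ 0 →
      link q (a t) (b t') → SolSym q Θ (a t) (b t') := by
    intro t t' ht ht' h3 h4 h5 hl
    have e1 := hΘ _ t ht (haB t h3 h4)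
    have e2 := hΘ _ t' ht' (hbB t' h5)
    rcases hl with hl | hl
    · exact Or.inl ⟨e1, e2, hl⟩
    · exact Or.inr ⟨e2, e1, hl⟩
  have hsm : tB a b m1 m2 s = tB a b m1 m2 s := rfl
  refine ⟨Θ, ?_, ⟨?_⟩⟩
  · intro c hc
    obtain ⟨i, hi⟩ := Set.mem_iUnion.1 hc
    have := i.2
    rcases hi with ⟨rfl, _⟩ | ⟨rfl, _⟩
    · exact haD _ (by omega)
    · exact hbD _ (by omega)
  have hv : ∀ t, t ≤ m2 → t < m2 + 1 := fun t h => by omega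
  exact
  { finite := Set.finite_iUnion fun i => (Set.toFinite {a i, b i}).subset (hsub2 i)
    m := m2 + 1
    blk := fun i => tB a b m1 m2 i
    blk_is_block := by
      intro i
      obtain ⟨c, hc⟩ := hnon i
      have hi : (i : ℕ) ≤ m2 := by have := i.2; omega
      refine ⟨c, hΘ c i hi hc, ?_⟩
      ext c'
      constructor
      · intro hc'
        exact ⟨hΘ c' i hi hc', kE_trans (kE_symm (hkB i hi c hc)) (hkB i hi c' hc')⟩
      · rintro ⟨h3, h4⟩
        obtain ⟨j, hj⟩ := Set.mem_iUnion.1 h3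
        have hj2 : (j : ℕ) ≤ m2 := by have := j.2; omega
        rw [hBB i hi j hj2 c hc c' hj h4]
        exact hj
    blk_cover := rfl
    blk_inj := by
      intro i j hij
      obtain ⟨c, hc⟩ := hnon i
      have hi : (i : ℕ) ≤ m2 := by have := i.2; omega
      have hj : (j : ℕ) ≤ m2 := by have := j.2; omega
      have hij' : tB a b m1 m2 i = tB a b m1 m2 j := hij
      exact Fin.ext (hBB i hi j hj c hc c (hij' ▸ hc) (kE_refl c))
    blk_card := by
      intro i
      exact (Set.ncard_le_ncard (hsub2 i) (Set.toFinite _)).trans ((Set.ncard_insert_le _ _).trans (by simp))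
    parent := tPar s m1 m2
    root := ⟨0, by omega⟩
    parent_root := by simp [tPar]
    parent_ne_root := by
      intro i hi
      have hi0 : (i : ℕ) ≠ 0 := fun h => hi (Fin.ext h)
      unfold tPar
      rw [if_neg hi0]
      split_ifs <;> exact ⟨_, rfl⟩
    reach_root := by
      intro i
      obtain ⟨t, ht⟩ := i
      induction t using Nat.strong_induction_on with
      | _ t ih =>
        by_cases h0 : t = 0
        · subst h0
          exact Relation.ReflTransGen.refl
        · by_cases hm : t = m1 + 1
          · exact Relation.ReflTransGen.head
              (b := ⟨s, by omega⟩) ((tPar_iff h1 h2 _ _).2 (Or.inl ⟨hm, rfl⟩))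
              (ih s (by omega) (by omega))
          · exact Relation.ReflTransGen.head
              (b := ⟨t - 1, by omega⟩) ((tPar_iff h1 h2 _ _).2
                (Or.inr ⟨hm, by simp only; omega⟩))
              (ih (t - 1) (by omega) (by omega))
    leaf1 := ⟨m1, by omega⟩
    leaf2 := ⟨m2, by omega⟩
    leaf_ne := by simp only [ne_eq, Fin.mk.injEq]; omega
    leaf1_leaf := by
      intro j h
      have := (tPar_iff h1 h2 _ _).1 h
      simp only at this
      omega
    leaf2_leaf := by
      intro j h
      have := (tPar_iff h1 h2 _ _).1 h
      have := j.2
      simp only at *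
      omega
    leaves_eq := by
      intro i h
      have hi := i.2
      by_contra hcon
      simp only [Fin.ext_iff, not_or] at hcon
      exact h ⟨i + 1, by omega⟩
        ((tPar_iff h1 h2 _ _).2 (Or.inr ⟨by simp only; omega, rfl⟩))
    aFact := fun i => a i
    bFact := fun i => b i
    root_blk := by
      ext c
      simp [tB]
      omega
    leaf1_blk := by
      ext c
      simp [tB]
      omega
    leaf2_blk := by
      ext c
      simp [tB]
      omega
    other_blk := by
      intro i h3 h4 h5
      have hi := i.2
      simp only [ne_eq, Fin.ext_iff] at h3 h4 h5
      refine ⟨hne i (by omega) h3 h4 h5, ?_⟩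
      ext c
      simp [tB, h3, h4, h5]
    adj_sol := by
      intro i j h
      have hi := i.2
      have hj := j.2
      rcases (tPar_iff h1 h2 _ _).1 h with ⟨h3, h4⟩ | ⟨h3, h4⟩
      · apply hSolSym <;> try omega
        rw [h3, h4]
        exact hlink2
      · apply hSolSym <;> try omega
        rw [h4]
        exact hlink _ (by omega) (by omega)
    branch := ⟨s, by omega⟩
    child1 := ⟨c1, by omega⟩
    child2 := ⟨c2, by omega⟩
    child_ne := by simp only [ne_eq, Fin.mk.injEq]; omega
    parent_child1 := (tPar_iff h1 h2 _ _).2 (by rcases hc with ⟨h, h'⟩ | ⟨h, h'⟩ <;> simp [h] <;> omega)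
    parent_child2 := (tPar_iff h1 h2 _ _).2 (by rcases hc with ⟨h, h'⟩ | ⟨h, h'⟩ <;> simp [h'] <;> omega)
    center_sol1 := ⟨hΘ _ c1 (by omega) (hbB _ (by omega)),
      hΘ _ s (by omega) (haB _ (by omega) (by omega)), hs1⟩
    center_sol2 := ⟨hΘ _ s (by omega) (haB _ (by omega) (by omega)),
      hΘ _ c2 (by omega) (hbB _ (by omega)), hs2⟩
    center_distinct := by
      intro h
      have h3 : b c1 = a s := congrArg Prod.fst h
      have := hBB c1 (by omega) s (by omega) _ (hbB c1 (by omega)) _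
        (haB s (by omega) (by omega)) (h3 ▸ kE_refl _)
      omega
    g_root := g0
    g_leaf1 := g1
    g_leaf2 := g2 }

theorem mk_tripath (hq : TwoWayDet l q) (a b : ℕ → (Fin n → Elem)) (s m1 m2 : ℕ) (hs : 1 ≤ s)
    (h1 : s < m1) (h2 : m1 < m2) (haD : ∀ t ≤ m2, a t ∈ D) (hbD : ∀ t ≤ m2, b t ∈ D)
    (hab : ∀ t ≤ m2, keyEq l (a t) (b t))
    (hne : ∀ t ≤ m2, t ≠ 0 → t ≠ m1 → t ≠ m2 → a t ≠ b t)
    (hdist : ∀ t t', t < t' → t' ≤ m2 → ¬ keyEq l (a t) (a t'))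
    (hlink : ∀ t, t + 1 ≤ m2 → t ≠ m1 → link q (a t) (b (t + 1)))
    (hlink2 : link q (a s) (b (m1 + 1)))
    (g0 : ¬ gSet l (b (s + 1)) (a s) (b (m1 + 1)) ⊆ keySet l (a 0))
    (g1 : ¬ gSet l (b (s + 1)) (a s) (b (m1 + 1)) ⊆ keySet l (b m1))
    (g2 : ¬ gSet l (b (s + 1)) (a s) (b (m1 + 1)) ⊆ keySet l (b m2)) :
    ContainsTripath l q D := by
  have hk : ¬ keyEq l (b (s + 1)) (b (m1 + 1)) := fun h =>
    hdist (s + 1) (m1 + 1) (by omega) (by omega)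
      (kE_trans (kE_trans (hab _ (by omega)) h) (kE_symm (hab _ (by omega))))
  rcases orient hq (hlink s (by omega) (by omega)) hlink2 hk with ⟨h3, h4⟩ | ⟨h3, h4⟩
  · exact mk_tripath_aux a b s m1 m2 hs h1 h2 haD hbD hab hne hdist hlink hlink2 (s + 1) (m1 + 1)
      (Or.inl ⟨rfl, rfl⟩) h3 h4 g0 g1 g2
  · rw [gSet_symm] at g0 g1 g2
    exact mk_tripath_aux a b s m1 m2 hs h1 h2 haD hbD hab hne hdist hlink hlink2 (m1 + 1) (s + 1)
      (Or.inr ⟨rfl, rfl⟩) h3 h4 g0 g1 g2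

structure Path (l : ℕ) (q : Query n Var) (D K : Set (Fin n → Elem)) (u0 : Fin n → Elem) (i : ℕ)
    (x p f fs : ℕ → (Fin n → Elem)) (H : Set ℕ) : Prop where
  xD : ∀ t ≤ i, x t ∈ D
  pD : ∀ t ≤ i, p t ∈ D
  xp : ∀ t ≤ i, keyEq l (x t) (p t)
  xne : ∀ t ≤ i, x t ≠ p t
  l0 : link q u0 (x 0)
  lx : ∀ t < i, link q (p t) (x (t + 1))
  Hlt : ∀ j ∈ H, j < i
  fD : ∀ j ∈ H, f j ∈ D
  fsD : ∀ j ∈ H, fs j ∈ D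
  ffs : ∀ j ∈ H, keyEq l (f j) (fs j)
  fne : ∀ j ∈ H, f j ≠ fs j
  lf : ∀ j ∈ H, link q (p j) (f j)
  dxx : ∀ s t, s < t → t ≤ i → ¬ keyEq l (x s) (x t)
  dfx : ∀ j ∈ H, ∀ t ≤ i, ¬ keyEq l (f j) (x t)
  dff : ∀ j ∈ H, ∀ j' ∈ H, keyEq l (f j) (f j') → j = j'
  dKx : ∀ t ≤ i, ∀ c ∈ K, ¬ keyEq l c (x t)
  dKf : ∀ j ∈ H, ∀ c ∈ K, ¬ keyEq l c (f j)

def VV (K : Set (Fin n → Elem)) (p fs : ℕ → (Fin n → Elem)) (H : Set ℕ) (i : ℕ) :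
    Set (Fin n → Elem) :=
  {c | c ∈ K ∨ (∃ t ≤ i, c = p t) ∨ ∃ j ∈ H, c = fs j}

def DE (l : ℕ) (x p f : ℕ → (Fin n → Elem)) (j i : ℕ) : Prop :=
  ∃ m m', j < m ∧ m < m' ∧ m' ≤ i ∧
    ¬ gSet l (x (j + 1)) (p j) (f j) ⊆ keySet l (x m) ∧
    ¬ gSet l (x (j + 1)) (p j) (f j) ⊆ keySet l (x m')

def SS (l : ℕ) (K : Set (Fin n → Elem)) (x p f fs : ℕ → (Fin n → Elem)) (H : Set ℕ) (i : ℕ) :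
    Set (Fin n → Elem) :=
  {c | c ∈ K ∨ c = p i ∨ ∃ j ∈ H, ¬ DE l x p f j i ∧ c = fs j}

variable {K : Set (Fin n → Elem)} {u0 : Fin n → Elem} {i : ℕ}
  {x p f fs : ℕ → (Fin n → Elem)} {H : Set ℕ}

theorem conflict (hq : TwoWayDet l q) (P : Path l q D K u0 i x p f fs H) (hu0 : u0 ∈ K)
    (hu0D : u0 ∈ D) (hK : ∀ c ∈ D, keySet l c ⊆ keySet l u0 → ∃ v ∈ K, keyEq l v c)
    {xx u : Fin n → Elem} (hxx : xx ∈ D) (hu : u ∈ D) (hlx : link q (p i) xx)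
    (hxu : keyEq l xx u) (hne : xx ≠ u) (hcov : ∀ v ∈ VV K p fs H i, ¬ keyEq l v xx)
    {j : ℕ} (hj : j ∈ H) (hlu : link q (fs j) u) (hDE : DE l x p f j i) :
    ContainsTripath l q D := by
  obtain ⟨m, m', hjm, hmm, hmi, hg1, hg2⟩ := hDE
  have hji := P.Hlt j hj
  let A : ℕ → (Fin n → Elem) := fun t => if t = 0 then u0 else if t ≤ m + 1 then p (t - 1) else
    if t = m + 2 then fs j else if t = m + 3 then xx else x (i - (t - (m + 4)))
  let B : ℕ → (Fin n → Elem) := fun t => if t = 0 then u0 else if t ≤ m + 1 then x (t - 1) else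
    if t = m + 2 then f j else if t = m + 3 then u else p (i - (t - (m + 4)))
  have A0 : A 0 = u0 := by simp [A]
  have B0 : B 0 = u0 := by simp [B]
  have A1 : ∀ v, v ≤ m → A (v + 1) = p v := by intro v hv; simp [A, hv]
  have B1 : ∀ v, v ≤ m → B (v + 1) = x v := by intro v hv; simp [B, hv]
  have A2 : A (m + 2) = fs j := by simp [A]
  have B2 : B (m + 2) = f j := by simp [B]
  have A3 : A (m + 3) = xx := by simp [A]
  have B3 : B (m + 3) = u := by simp [B]
  have A4 : ∀ c, A (m + 4 + c) = x (i - c) := by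
    intro c
    have e1 : m + 4 + c ≠ 0 := by omega
    have e2 : ¬ m + 4 + c ≤ m + 1 := by omega
    have e3 : m + 4 + c ≠ m + 2 := by omega
    have e4 : m + 4 + c ≠ m + 3 := by omega
    have e5 : m + 4 + c - (m + 4) = c := by omega
    simp only [A, e1, e2, e3, e4, e5, if_false]
  have B4 : ∀ c, B (m + 4 + c) = p (i - c) := by
    intro c
    have e1 : m + 4 + c ≠ 0 := by omega
    have e2 : ¬ m + 4 + c ≤ m + 1 := by omega
    have e3 : m + 4 + c ≠ m + 2 := by omega
    have e4 : m + 4 + c ≠ m + 3 := by omega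
    have e5 : m + 4 + c - (m + 4) = c := by omega
    simp only [B, e1, e2, e3, e4, e5, if_false]
  have hcs : ∀ t ≤ m + 4 + (i - m'), t = 0 ∨ (∃ v ≤ m, t = v + 1) ∨ t = m + 2 ∨ t = m + 3 ∨
      ∃ c ≤ i - m', t = m + 4 + c := by
    intro t ht
    by_cases h0 : t = 0
    · exact Or.inl h0
    by_cases h1 : t ≤ m + 1
    · exact Or.inr (Or.inl ⟨t - 1, by omega, by omega⟩)
    by_cases h2 : t = m + 2
    · exact Or.inr (Or.inr (Or.inl h2))
    by_cases h3 : t = m + 3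
    · exact Or.inr (Or.inr (Or.inr (Or.inl h3)))
    exact Or.inr (Or.inr (Or.inr (Or.inr ⟨t - (m + 4), by omega, by omega⟩)))
  have cK : ∀ t ≤ i, ¬ keyEq l u0 (x t) := fun t ht => P.dKx t ht u0 hu0
  have cKp : ∀ t ≤ i, ¬ keyEq l u0 (p t) := fun t ht h =>
    cK t ht (kE_trans h (kE_symm (P.xp t ht)))
  have cX : ∀ t ≤ i, ¬ keyEq l (p t) xx := fun t ht => hcov _ (Or.inr (Or.inl ⟨t, ht, rfl⟩))
  have cF : ¬ keyEq l (fs j) xx := hcov _ (Or.inr (Or.inr ⟨j, hj, rfl⟩))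
  have cU : ¬ keyEq l u0 xx := hcov _ (Or.inl hu0)
  have cFx : ∀ t ≤ i, ¬ keyEq l (fs j) (x t) := fun t ht h =>
    P.dfx j hj t ht (kE_trans (P.ffs j hj) h)
  have cpF : ∀ t ≤ i, ¬ keyEq l (p t) (fs j) := fun t ht h =>
    cFx t ht (kE_trans (kE_symm h) (kE_symm (P.xp t ht)))
  have cpp : ∀ s t, s < t → t ≤ i → ¬ keyEq l (p s) (p t) := fun s t hs ht h =>
    P.dxx s t hs ht (kE_trans (kE_trans (P.xp s (by omega)) h) (kE_symm (P.xp t ht)))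
  have cpx : ∀ s t, s < t → t ≤ i → ¬ keyEq l (p s) (x t) := fun s t hs ht h =>
    P.dxx s t hs ht (kE_trans (P.xp s (by omega)) h)
  have hg0 : ¬ gSet l (x (j + 1)) (p j) (f j) ⊆ keySet l u0 := by
    intro h
    rcases gSet_cases (l := l) (x (j + 1)) (p j) (f j) with h' | h' | h' <;> rw [h'] at h
    · obtain ⟨v, hv, hvc⟩ := hK _ (P.xD (j + 1) (by omega)) h
      exact P.dKx _ (by omega) v hv hvc
    · obtain ⟨v, hv, hvc⟩ := hK _ (P.pD j (by omega)) h
      exact P.dKx _ (by omega) v hv (kE_trans hvc (kE_symm (P.xp j (by omega))))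
    · obtain ⟨v, hv, hvc⟩ := hK _ (P.fD j hj) h
      exact P.dKf _ hj v hv hvc
  refine mk_tripath hq A B (j + 1) (m + 1) (m + 4 + (i - m')) (by omega) (by omega) (by omega)
    ?_ ?_ ?_ ?_ ?_ ?_ ?_ ?_ ?_ ?_
  · intro t ht
    rcases hcs t ht with rfl | ⟨v, hv, rfl⟩ | rfl | rfl | ⟨c, hc, rfl⟩
    · rwa [A0]
    · rw [A1 v hv]; exact P.pD v (by omega)
    · rw [A2]; exact P.fsD j hj
    · rwa [A3]
    · rw [A4]; exact P.xD _ (by omega)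
  · intro t ht
    rcases hcs t ht with rfl | ⟨v, hv, rfl⟩ | rfl | rfl | ⟨c, hc, rfl⟩
    · rwa [B0]
    · rw [B1 v hv]; exact P.xD v (by omega)
    · rw [B2]; exact P.fD j hj
    · rwa [B3]
    · rw [B4]; exact P.pD _ (by omega)
  · intro t ht
    rcases hcs t ht with rfl | ⟨v, hv, rfl⟩ | rfl | rfl | ⟨c, hc, rfl⟩
    · rw [A0, B0]; exact kE_refl _
    · rw [A1 v hv, B1 v hv]; exact kE_symm (P.xp v (by omega))
    · rw [A2, B2]; exact kE_symm (P.ffs j hj)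
    · rw [A3, B3]; exact hxu
    · rw [A4, B4]; exact P.xp _ (by omega)
  · intro t ht ht0 _ _
    rcases hcs t ht with rfl | ⟨v, hv, rfl⟩ | rfl | rfl | ⟨c, hc, rfl⟩
    · exact absurd rfl ht0
    · rw [A1 v hv, B1 v hv]; exact (P.xne v (by omega)).symm
    · rw [A2, B2]; exact (P.fne j hj).symm
    · rw [A3, B3]; exact hne
    · rw [A4, B4]; exact P.xne _ (by omega)
  · intro t t' htt ht'
    have hcx : ∀ c ≤ i - m', ¬ keyEq l xx (x (i - c)) := fun c hc h =>
      cX (i - c) (by omega) (kE_trans (kE_symm (P.xp _ (by omega))) (kE_symm h))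
    rcases hcs t (by omega) with rfl | ⟨v, hv, rfl⟩ | rfl | rfl | ⟨c, hc, rfl⟩ <;>
    rcases hcs t' ht' with rfl | ⟨v', hv', rfl⟩ | rfl | rfl | ⟨c', hc', rfl⟩ <;>
    first
    | omega
    | skip
    · rw [A0, A1 _ hv']; exact cKp _ (by omega)
    · rw [A0, A2]; exact fun h => P.dKf j hj u0 hu0 (kE_trans h (kE_symm (P.ffs j hj)))
    · rw [A0, A3]; exact cU
    · rw [A0, A4]; exact cK _ (by omega)
    · rw [A1 _ hv, A1 _ hv']; exact cpp _ _ (by omega) (by omega)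
    · rw [A1 _ hv, A2]; exact cpF _ (by omega)
    · rw [A1 _ hv, A3]; exact cX _ (by omega)
    · rw [A1 _ hv, A4]; exact cpx _ _ (by omega) (by omega)
    · rw [A2, A3]; exact cF
    · rw [A2, A4]; exact cFx _ (by omega)
    · rw [A3, A4]; exact hcx _ hc'
    · rw [A4, A4]; exact fun h => P.dxx (i - c') (i - c) (by omega) (by omega) (kE_symm h)
  · intro t ht htm
    rcases hcs t (by omega) with rfl | ⟨v, hv, rfl⟩ | rfl | rfl | ⟨c, hc, rfl⟩
    · rw [A0, B1 0 (by omega)]; exact P.l0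
    · rw [A1 v hv, B1 (v + 1) (by omega)]; exact P.lx v (by omega)
    · rw [A2, B3]; exact hlu
    · rw [A3]
      have := B4 0
      simp only [Nat.add_zero, Nat.sub_zero] at this
      rw [this]
      exact link_symm hlx
    · rw [A4, show m + 4 + c + 1 = m + 4 + (c + 1) by omega, B4]
      have := P.lx (i - (c + 1)) (by omega)
      rw [show i - (c + 1) + 1 = i - c by omega] at this
      exact link_symm this
  · rw [A1 j (by omega), B2]; exact P.lf j hj
  · rw [A1 j (by omega), B1 (j + 1) (by omega), B2, A0]; exact hg0
  · rw [A1 j (by omega), B1 (j + 1) (by omega), B2, B1 m le_rfl]; exact hg1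
  · rw [A1 j (by omega), B1 (j + 1) (by omega), B2, B4, show i - (i - m') = m' by omega,
      ← kS_eq (P.xp m' hmi)]
    exact hg2

theorem countG (hl : l ≤ n) (P : Path l q D K u0 i x p f fs H) (J : Finset ℕ)
    (hJ : ∀ j ∈ J, j ∈ H) (w : Fin n → Elem)
    (h : ∀ j ∈ J, gSet l (x (j + 1)) (p j) (f j) ⊆ keySet l w) : J.card ≤ 2 * l ^ l := by
  classical
  have hsplit := Finset.card_filter_add_card_filter_not (s := J)
    (fun j => gSet l (x (j + 1)) (p j) (f j) = keySet l (x (j + 1)))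
  have h1 : (J.filter (fun j => gSet l (x (j + 1)) (p j) (f j) = keySet l (x (j + 1)))).card
      ≤ l ^ l := by
    refine count_le hl _ (fun j => x (j + 1)) w ?_ ?_
    · intro j hj
      rw [Finset.mem_filter] at hj
      rw [← hj.2]
      exact h j hj.1
    · intro j hj j' hj' hk
      rw [Finset.mem_filter] at hj hj'
      have e1 := P.Hlt j (hJ j hj.1)
      have e2 := P.Hlt j' (hJ j' hj'.1)
      rcases lt_trichotomy j j' with h3 | h3 | h3
      · exact absurd hk (P.dxx _ _ (by omega) (by omega))
      · exact h3
      · exact absurd (kE_symm hk) (P.dxx _ _ (by omega) (by omega))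
  have h2 : (J.filter (fun j => ¬ gSet l (x (j + 1)) (p j) (f j) = keySet l (x (j + 1)))).card
      ≤ l ^ l := by
    refine count_le hl _ (fun j => if gSet l (x (j + 1)) (p j) (f j) = keySet l (p j) then x j
      else f j) w ?_ ?_
    · intro j hj
      rw [Finset.mem_filter] at hj
      have e1 := P.Hlt j (hJ j hj.1)
      have e3 := h j hj.1
      rcases gSet_cases (l := l) (x (j + 1)) (p j) (f j) with h' | h' | h'
      · exact absurd h' hj.2
      · rw [if_pos h', kS_eq (P.xp j (by omega)), ← h']
        exact e3
      · split_ifs with h4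
        · rw [kS_eq (P.xp j (by omega)), ← h4]
          exact e3
        · rw [← h']
          exact e3
    · intro j hj j' hj' hk
      rw [Finset.mem_filter] at hj hj'
      have e1 := P.Hlt j (hJ j hj.1)
      have e2 := P.Hlt j' (hJ j' hj'.1)
      split_ifs at hk
      · rcases lt_trichotomy j j' with h3 | h3 | h3
        · exact absurd hk (P.dxx _ _ (by omega) (by omega))
        · exact h3
        · exact absurd (kE_symm hk) (P.dxx _ _ (by omega) (by omega))
      · exact absurd (kE_symm hk) (P.dfx j' (hJ j' hj'.1) j (by omega))
      · exact absurd hk (P.dfx j (hJ j hj.1) j' (by omega))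
      · exact P.dff j (hJ j hj.1) j' (hJ j' hj'.1) hk
  omega

theorem SS_card (hl : l ≤ n) (P : Path l q D K u0 i x p f fs H) (hKf : K.Finite)
    (hKc : K.ncard ≤ l ^ l) : (SS l K x p f fs H i).ncard ≤ 5 * l ^ l + 1 := by
  classical
  let J1 := (Finset.range i).filter (fun j => j ∈ H ∧
    gSet l (x (j + 1)) (p j) (f j) ⊆ keySet l (x i))
  let J2 := (Finset.range i).filter (fun j => j ∈ H ∧
    gSet l (x (j + 1)) (p j) (f j) ⊆ keySet l (x (i - 1)))
  have c1 : J1.card ≤ 2 * l ^ l := countG hl P J1 (fun j hj => (Finset.mem_filter.1 hj).2.1) (x i)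
    (fun j hj => (Finset.mem_filter.1 hj).2.2)
  have c2 : J2.card ≤ 2 * l ^ l := countG hl P J2 (fun j hj => (Finset.mem_filter.1 hj).2.1)
    (x (i - 1)) (fun j hj => (Finset.mem_filter.1 hj).2.2)
  let T : Finset (Fin n → Elem) := hKf.toFinset ∪ ({p i} ∪ (J1.image fs ∪ J2.image fs))
  have hT : SS l K x p f fs H i ⊆ (T : Set (Fin n → Elem)) := by
    rintro c (hc | rfl | ⟨j, hj, hde, rfl⟩)
    · simp [T, hc]
    · simp [T]
    · have hji := P.Hlt j hj
      have : j ∈ J1 ∨ j ∈ J2 := by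
        by_cases h1 : gSet l (x (j + 1)) (p j) (f j) ⊆ keySet l (x i)
        · exact Or.inl (Finset.mem_filter.2 ⟨Finset.mem_range.2 hji, hj, h1⟩)
        · refine Or.inr (Finset.mem_filter.2 ⟨Finset.mem_range.2 hji, hj, ?_⟩)
          by_cases h2 : j = i - 1
          · rw [← h2, kS_eq (P.xp j (by omega))]
            exact gSet_sub _ _ _
          · by_contra h3
            exact hde ⟨i - 1, i, by omega, by omega, le_rfl, h3, h1⟩
      have h4 : fs j ∈ J1.image fs ∪ J2.image fs := by
        rcases this with h | h
        · exact Finset.mem_union_left _ (Finset.mem_image_of_mem fs h)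
        · exact Finset.mem_union_right _ (Finset.mem_image_of_mem fs h)
      exact Finset.mem_coe.2 (Finset.mem_union_right _ (Finset.mem_union_right _ h4))
  have h1 := Set.ncard_le_ncard hT (Finset.finite_toSet T)
  rw [Set.ncard_coe_finset] at h1
  have h2 : T.card ≤ hKf.toFinset.card + (1 + (J1.card + J2.card)) :=
    (Finset.card_union_le _ _).trans (Nat.add_le_add_left
      ((Finset.card_union_le _ _).trans (Nat.add_le_add (by simp)
        ((Finset.card_union_le _ _).trans
          (Nat.add_le_add Finset.card_image_le Finset.card_image_le)))) _)
  rw [← Set.ncard_eq_toFinset_card K hKf] at h2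
  omega

def ext1 (i : ℕ) (x : ℕ → (Fin n → Elem)) (xx : Fin n → Elem) : ℕ → (Fin n → Elem) :=
  fun t => if t ≤ i then x t else xx
theorem ext1_le {t : ℕ} (h : t ≤ i) (xx : Fin n → Elem) : ext1 i x xx t = x t := if_pos h
theorem ext1_s (xx : Fin n → Elem) : ext1 i x xx (i + 1) = xx := if_neg (by omega)

def ext2 (i : ℕ) (x : ℕ → (Fin n → Elem)) (xx : Fin n → Elem) : ℕ → (Fin n → Elem) :=
  fun t => if t = i then xx else x t
theorem ext2_lt {t : ℕ} (h : t < i) (xx : Fin n → Elem) : ext2 i x xx t = x t :=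
  if_neg (by omega)
theorem ext2_s (xx : Fin n → Elem) : ext2 i x xx i = xx := if_pos rfl

def HH (H : Set ℕ) (i : ℕ) (b : Prop) : Set ℕ := {j | j ∈ H ∨ (j = i ∧ b)}

def add2 (S : Set (Fin n → Elem)) (pp ff : Fin n → Elem) (b : Prop) : Set (Fin n → Elem) :=
  {c | c ∈ S ∨ c = pp ∨ (b ∧ c = ff)}

theorem path_ext (P : Path l q D K u0 i x p f fs H) {xx pp ff gg : Fin n → Elem} {b : Prop}
    (hxx : xx ∈ D) (hpp : pp ∈ D) (hk : keyEq l xx pp) (hne : xx ≠ pp) (hlk : link q (p i) xx)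
    (hc : ∀ v ∈ VV K p fs H i, ¬ keyEq l v xx)
    (hb : b → ff ∈ D ∧ gg ∈ D ∧ keyEq l ff gg ∧ ff ≠ gg ∧ link q (p i) ff ∧
      (∀ v ∈ VV K p fs H i, ¬ keyEq l v ff) ∧ ¬ keyEq l ff xx) :
    Path l q D K u0 (i + 1) (ext1 i x xx) (ext1 i p pp) (ext2 i f ff) (ext2 i fs gg) (HH H i b)
    where
  xD := by
    intro t ht
    rcases Nat.le_succ_iff.1 ht with h | rfl
    · rw [ext1_le h]; exact P.xD t h
    · rw [ext1_s]; exact hxx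
  pD := by
    intro t ht
    rcases Nat.le_succ_iff.1 ht with h | rfl
    · rw [ext1_le h]; exact P.pD t h
    · rw [ext1_s]; exact hpp
  xp := by
    intro t ht
    rcases Nat.le_succ_iff.1 ht with h | rfl
    · rw [ext1_le h, ext1_le h]; exact P.xp t h
    · rw [ext1_s, ext1_s]; exact hk
  xne := by
    intro t ht
    rcases Nat.le_succ_iff.1 ht with h | rfl
    · rw [ext1_le h, ext1_le h]; exact P.xne t h
    · rw [ext1_s, ext1_s]; exact hne
  l0 := by
    rw [ext1_le (Nat.zero_le _)]; exact P.l0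
  lx := by
    intro t ht
    rcases Nat.lt_succ_iff_lt_or_eq.1 ht with h | rfl
    · rw [ext1_le h.le, ext1_le h]; exact P.lx t h
    · rw [ext1_le le_rfl, ext1_s]; exact hlk
  Hlt := by
    rintro j (hj | ⟨rfl, -⟩)
    · exact (P.Hlt j hj).trans (by omega)
    · omega
  fD := by
    rintro j (hj | ⟨rfl, h⟩)
    · rw [ext2_lt (P.Hlt j hj)]; exact P.fD j hj
    · rw [ext2_s]; exact (hb h).1
  fsD := by
    rintro j (hj | ⟨rfl, h⟩)
    · rw [ext2_lt (P.Hlt j hj)]; exact P.fsD j hj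
    · rw [ext2_s]; exact (hb h).2.1
  ffs := by
    rintro j (hj | ⟨rfl, h⟩)
    · rw [ext2_lt (P.Hlt j hj), ext2_lt (P.Hlt j hj)]; exact P.ffs j hj
    · rw [ext2_s, ext2_s]; exact (hb h).2.2.1
  fne := by
    rintro j (hj | ⟨rfl, h⟩)
    · rw [ext2_lt (P.Hlt j hj), ext2_lt (P.Hlt j hj)]; exact P.fne j hj
    · rw [ext2_s, ext2_s]; exact (hb h).2.2.2.1
  lf := by
    rintro j (hj | ⟨rfl, h⟩)
    · rw [ext2_lt (P.Hlt j hj), ext1_le (P.Hlt j hj).le]; exact P.lf j hj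
    · rw [ext2_s, ext1_le le_rfl]; exact (hb h).2.2.2.2.1
  dxx := by
    intro s t hst ht
    rcases Nat.le_succ_iff.1 ht with h | rfl
    · rw [ext1_le h, ext1_le (hst.le.trans h)]; exact P.dxx s t hst h
    · rw [ext1_s, ext1_le (by omega)]
      exact fun h => hc _ (Or.inr (Or.inl ⟨s, by omega, rfl⟩))
        (kE_trans (kE_symm (P.xp s (by omega))) h)
  dfx := by
    rintro j (hj | ⟨rfl, hbb⟩) t ht <;> rcases Nat.le_succ_iff.1 ht with h | rfl
    · rw [ext2_lt (P.Hlt j hj), ext1_le h]; exact P.dfx j hj t h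
    · rw [ext2_lt (P.Hlt j hj), ext1_s]
      exact fun h => hc _ (Or.inr (Or.inr ⟨j, hj, rfl⟩)) (kE_trans (kE_symm (P.ffs j hj)) h)
    · rw [ext2_s, ext1_le h]
      exact fun h' => (hb hbb).2.2.2.2.2.1 _ (Or.inr (Or.inl ⟨t, h, rfl⟩))
        (kE_trans (kE_symm (P.xp t h)) (kE_symm h'))
    · rw [ext2_s, ext1_s]; exact (hb hbb).2.2.2.2.2.2
  dff := by
    have aux : ∀ j ∈ H, b → ¬ keyEq l (f j) ff := fun j hj hbb h =>
      (hb hbb).2.2.2.2.2.1 _ (Or.inr (Or.inr ⟨j, hj, rfl⟩)) (kE_trans (kE_symm (P.ffs j hj)) h)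
    rintro j (hj | ⟨rfl, hbb⟩) j' (hj' | ⟨rfl, hbb'⟩) h
    · rw [ext2_lt (P.Hlt j hj), ext2_lt (P.Hlt j' hj')] at h; exact P.dff j hj j' hj' h
    · rw [ext2_lt (P.Hlt j hj), ext2_s] at h
      exact absurd h (aux j hj hbb')
    · rw [ext2_lt (P.Hlt j' hj'), ext2_s] at h
      exact absurd (kE_symm h) (aux j' hj' hbb)
    · rfl
  dKx := by
    intro t ht c hcK
    rcases Nat.le_succ_iff.1 ht with h | rfl
    · rw [ext1_le h]; exact P.dKx t h c hcK
    · rw [ext1_s]; exact hc c (Or.inl hcK)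
  dKf := by
    rintro j (hj | ⟨rfl, h⟩) c hcK
    · rw [ext2_lt (P.Hlt j hj)]; exact P.dKf j hj c hcK
    · rw [ext2_s]; exact (hb h).2.2.2.2.2.1 c (Or.inl hcK)

theorem VV_ext (hH : ∀ j ∈ H, j < i) (pp gg : Fin n → Elem) (b : Prop) :
    VV K (ext1 i p pp) (ext2 i fs gg) (HH H i b) (i + 1) = add2 (VV K p fs H i) pp gg b := by
  ext c
  constructor
  · rintro (h | ⟨t, ht, rfl⟩ | ⟨j, hj | ⟨rfl, hbb⟩, rfl⟩)
    · exact Or.inl (Or.inl h)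
    · rcases Nat.le_succ_iff.1 ht with h | rfl
      · rw [ext1_le h]; exact Or.inl (Or.inr (Or.inl ⟨t, h, rfl⟩))
      · rw [ext1_s]; exact Or.inr (Or.inl rfl)
    · rw [ext2_lt (hH j hj)]; exact Or.inl (Or.inr (Or.inr ⟨j, hj, rfl⟩))
    · rw [ext2_s]; exact Or.inr (Or.inr ⟨hbb, rfl⟩)
  · rintro ((h | ⟨t, ht, rfl⟩ | ⟨j, hj, rfl⟩) | rfl | ⟨hbb, rfl⟩)
    · exact Or.inl h
    · exact Or.inr (Or.inl ⟨t, by omega, (ext1_le ht _).symm⟩)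
    · exact Or.inr (Or.inr ⟨j, Or.inl hj, (ext2_lt (hH j hj) _).symm⟩)
    · exact Or.inr (Or.inl ⟨i + 1, le_rfl, (ext1_s _).symm⟩)
    · exact Or.inr (Or.inr ⟨i, Or.inr ⟨rfl, hbb⟩, (ext2_s _).symm⟩)

theorem SS_ext (hH : ∀ j ∈ H, j < i) (xx pp ff gg : Fin n → Elem) (b : Prop) :
    SS l K (ext1 i x xx) (ext1 i p pp) (ext2 i f ff) (ext2 i fs gg) (HH H i b) (i + 1) ⊆
      add2 (SS l K x p f fs H i) pp gg b := by
  rintro c (h | rfl | ⟨j, hj | ⟨rfl, hbb⟩, hde, rfl⟩)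
  · exact Or.inl (Or.inl h)
  · rw [ext1_s]; exact Or.inr (Or.inl rfl)
  · have hji := hH j hj
    rw [ext2_lt hji]
    refine Or.inl (Or.inr (Or.inr ⟨j, hj, fun h => hde ?_, rfl⟩))
    obtain ⟨m, m', h1, h2, h3, h4, h5⟩ := h
    refine ⟨m, m', h1, h2, by omega, ?_, ?_⟩
    · rw [ext1_le (by omega), ext1_le (by omega), ext2_lt hji, ext1_le (by omega)]; exact h4
    · rw [ext1_le (by omega), ext1_le (by omega), ext2_lt hji, ext1_le (by omega)]; exact h5
  · rw [ext2_s]; exact Or.inr (Or.inr ⟨hbb, rfl⟩)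

def St (l k : ℕ) (q : Query n Var) (D K : Set (Fin n → Elem)) (u0 : Fin n → Elem) (i : ℕ) : Prop :=
  ∃ (x p f fs : ℕ → (Fin n → Elem)) (H : Set ℕ) (r : Set (Fin n → Elem)),
    Path l q D K u0 i x p f fs H ∧ MinR l q D (VV K p fs H i) r ∧ (∃ y ∈ r, link q (p i) y) ∧
    (∀ v ∈ VV K p fs H i, ¬ link q (p i) v) ∧
    (∀ j < i, ∀ z ∈ D, link q (p j) z → ∃ v ∈ VV K p fs H i, keyEq l v z) ∧
    Live l k q D (SS l K x p f fs H i)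

theorem St_ext (hDn : D.Nonempty) (P : Path l q D K u0 i x p f fs H)
    (h8 : ∀ j < i, ∀ z ∈ D, link q (p j) z → ∃ v ∈ VV K p fs H i, keyEq l v z)
    {xx pp ff gg : Fin n → Elem} {b : Prop} {r : Set (Fin n → Elem)}
    (hxx : xx ∈ D) (hpp : pp ∈ D) (hk : keyEq l xx pp) (hne : xx ≠ pp) (hlk : link q (p i) xx)
    (hc : ∀ v ∈ VV K p fs H i, ¬ keyEq l v xx)
    (hb : b → ff ∈ D ∧ gg ∈ D ∧ keyEq l ff gg ∧ ff ≠ gg ∧ link q (p i) ff ∧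
      (∀ v ∈ VV K p fs H i, ¬ keyEq l v ff) ∧ ¬ keyEq l ff xx)
    (hr : MinR l q D (add2 (VV K p fs H i) pp gg b) r) (hact : ∃ y ∈ r, link q pp y)
    (hnl : ∀ v ∈ add2 (VV K p fs H i) pp gg b, ¬ link q pp v)
    (h8' : ∀ z ∈ D, link q (p i) z → ∃ v ∈ add2 (VV K p fs H i) pp gg b, keyEq l v z)
    (hL : Live l k q D (add2 (SS l K x p f fs H i) pp gg b)) : St l k q D K u0 (i + 1) := by
  refine ⟨_, _, _, _, _, r, path_ext P hxx hpp hk hne hlk hc hb, ?_, ?_, ?_, ?_, ?_⟩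
  · rw [VV_ext P.Hlt]; exact hr
  · rw [ext1_s]; exact hact
  · rw [ext1_s, VV_ext P.Hlt]; exact hnl
  · rw [VV_ext P.Hlt]
    intro j hj z hz hlz
    rcases Nat.lt_succ_iff_lt_or_eq.1 hj with h | rfl
    · rw [ext1_le h.le] at hlz
      obtain ⟨v, hv, hvz⟩ := h8 j h z hz hlz
      exact ⟨v, Or.inl hv, hvz⟩
    · rw [ext1_le le_rfl] at hlz
      exact h8' z hz hlz
  · exact live_mono hDn hL (SS_ext P.Hlt _ _ _ _ _)

theorem SS_sub_VV : SS l K x p f fs H i ⊆ VV K p fs H i := by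
  rintro c (h | rfl | ⟨j, hj, -, rfl⟩)
  · exact Or.inl h
  · exact Or.inr (Or.inl ⟨i, le_rfl, rfl⟩)
  · exact Or.inr (Or.inr ⟨j, hj, rfl⟩)

theorem add2_false (S : Set (Fin n → Elem)) (pp gg : Fin n → Elem) :
    add2 S pp gg False = S ∪ {pp} := by
  ext c; simp [add2]; tauto

theorem nolink (hq : TwoWayDet l q) (hnt : ¬ ContainsTripath l q D)
    (P : Path l q D K u0 i x p f fs H) (hu0 : u0 ∈ K)
    (hu0D : u0 ∈ D) (hK : ∀ c ∈ D, keySet l c ⊆ keySet l u0 → ∃ v ∈ K, keyEq l v c)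
    (h8 : ∀ j < i, ∀ z ∈ D, link q (p j) z → ∃ v ∈ VV K p fs H i, keyEq l v z)
    {y u : Fin n → Elem} (hy : y ∈ D) (hu : u ∈ D) (hly : link q (p i) y)
    (hyu : keyEq l y u) (hcov : ∀ v ∈ VV K p fs H i, ¬ keyEq l v y)
    {T : Set (Fin n → Elem)} (hT : SS l K x p f fs H i ⊆ T) (hL : Live l k q D T) (huT : u ∈ T) :
    y ≠ u ∧ ∀ v ∈ VV K p fs H i, ¬ link q u v := by
  have hne : y ≠ u := by
    rintro rfl
    exact live_nolink hL (hT (Or.inr (Or.inl rfl))) huT hly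
  refine ⟨hne, fun v hv hlv => ?_⟩
  rcases hv with h | ⟨t, ht, rfl⟩ | ⟨j, hj, rfl⟩
  · exact live_nolink hL huT (hT (Or.inl h)) hlv
  · rcases ht.lt_or_eq with h | rfl
    · obtain ⟨v, hv, hvu⟩ := h8 t h u hu (link_symm hlv)
      exact hcov v hv (kE_trans hvu (kE_symm hyu))
    · exact live_nolink hL huT (hT (Or.inr (Or.inl rfl))) hlv
  · by_cases hde : DE l x p f j i
    · exact hnt (conflict hq P hu0 hu0D hK hy hu hly hyu hne hcov hj (link_symm hlv) hde)
    · exact live_nolink hL huT (hT (Or.inr (Or.inr ⟨j, hj, hde, rfl⟩))) hlv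

theorem St_step (hq : TwoWayDet l q) (hl : l ≤ n) (hD : D.Finite)
    (hnt : ¬ ContainsTripath l q D) (hu0 : u0 ∈ K) (hu0D : u0 ∈ D)
    (hK : ∀ c ∈ D, keySet l c ⊆ keySet l u0 → ∃ v ∈ K, keyEq l v c) (hKf : K.Finite)
    (hKc : K.ncard ≤ l ^ l) (hk : 5 * l ^ l + 3 ≤ k) (h : St l k q D K u0 i) :
    St l k q D K u0 (i + 1) := by
  obtain ⟨x, p, f, fs, H, r, P, hr, ⟨y, hyr, hly⟩, h7, h8, hL⟩ := h
  have hDn : D.Nonempty := ⟨u0, hu0D⟩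
  have hpV : p i ∈ VV K p fs H i := Or.inr (Or.inl ⟨i, le_rfl, rfl⟩)
  have hyD : y ∈ D := hr.1.1 hyr
  have hcy : ∀ v ∈ VV K p fs H i, ¬ keyEq l v y := by
    intro v hv hvy
    have := hr.1.2.1 v (hr.2.1 hv) y hyr hvy
    exact h7 v hv (this ▸ hly)
  have hcard := SS_card hl P hKf hKc
  obtain ⟨u1, hu1D, hyu1, hL1⟩ := live_extend hL hyD (fun s hs => hcy s (SS_sub_VV hs)) (by omega)
  obtain ⟨hne1, hnl1⟩ := nolink hq hnt P hu0 hu0D hK h8 hyD hu1D hly hyu1 hcy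
    (Set.subset_insert _ _) hL1 (Set.mem_insert _ _)
  have hcu1 : ∀ v ∈ VV K p fs H i, ¬ keyEq l u1 v := fun v hv h =>
    hcy v hv (kE_symm (kE_trans hyu1 h))
  obtain ⟨r1, hr1, hact1⟩ := min_step hD hr (W := {u1}) (by simpa using hu1D)
    (by rintro a rfl b rfl _; rfl)
    (by rintro v hv w rfl h; exact absurd h (hcu1 v hv))
  have hu1r1 : u1 ∈ r1 := hr1.2.1 (Or.inr rfl)
  have hact1' : ∃ y1 ∈ r1, link q u1 y1 := by
    rcases hact1 with ⟨w, rfl, h⟩ | h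
    · exact h
    · have := link_of_solSet_eq h (hr.2.1 hpV) hyr hly
      exact absurd (hr1.1.2.1 y this.2 u1 hu1r1 hyu1) hne1
  clear hact1
  obtain ⟨y1, hy1r, hly1⟩ := hact1'
  by_cases hsec : ∃ f' ∈ D, link q (p i) f' ∧ ¬ keyEq l y f' ∧
      ∀ v ∈ VV K p fs H i, ¬ keyEq l v f'
  · obtain ⟨f', hfD, hlf, hyf, hcf⟩ := hsec
    obtain ⟨u2, hu2D, hfu2, hL2⟩ := live_extend hL1 hfD (by
      rintro s (rfl | hs)
      · exact fun h => hyf (kE_trans hyu1 h)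
      · exact hcf s (SS_sub_VV hs)) (by
        have := Set.ncard_insert_le u1 (SS l K x p f fs H i)
        omega)
    have hsub : SS l K x p f fs H i ⊆ insert u2 (insert u1 (SS l K x p f fs H i)) :=
      (Set.subset_insert _ _).trans (Set.subset_insert _ _)
    have m1 : u1 ∈ insert u2 (insert u1 (SS l K x p f fs H i)) := Or.inr (Or.inl rfl)
    have m2 : u2 ∈ insert u2 (insert u1 (SS l K x p f fs H i)) := Or.inl rfl
    obtain ⟨hne2, hnl2⟩ := nolink hq hnt P hu0 hu0D hK h8 hfD hu2D hlf hfu2 hcf hsub hL2 m2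
    obtain ⟨r2, hr2, hact2⟩ := min_step hD hr1 (W := {u2}) (by simpa using hu2D)
      (by rintro a rfl b rfl _; rfl)
      (by
        rintro v (hv | rfl) w rfl h
        · exact absurd (kE_symm (kE_trans hfu2 h)) (hcf v hv)
        · exact absurd (kE_trans hyu1 (kE_symm (kE_trans hfu2 h))) hyf)
    have hcov8 : ∀ z ∈ D, link q (p i) z → ∃ v, (v = u1 ∨ v = u2) ∧ keyEq l v z := by
      intro z hz hlz
      rcases nbr_two hq hly hlf hyf hlz with h | h
      · exact ⟨u1, Or.inl rfl, kE_trans (kE_symm hyu1) h⟩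
      · exact ⟨u2, Or.inr rfl, kE_trans (kE_symm hfu2) h⟩
    rcases hact2 with ⟨w, rfl, h⟩ | h
    · refine St_ext (b := True) hDn P h8 hfD hu2D hfu2 hne2 hlf hcf
        (fun _ => ⟨hyD, hu1D, hyu1, hne1, hly, hcy, hyf⟩) (r := r2) ?_ h ?_ ?_ ?_
      · have : add2 (VV K p fs H i) w u1 True = VV K p fs H i ∪ {u1} ∪ {w} := by
          ext c; simp [add2]; tauto
        rwa [this]
      · rintro v (hv | rfl | ⟨-, rfl⟩)
        · exact hnl2 v hv
        · exact live_nolink hL2 m2 m2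
        · exact live_nolink hL2 m2 m1
      · intro z hz hlz
        obtain ⟨v, rfl | rfl, hvz⟩ := hcov8 z hz hlz
        · exact ⟨v, Or.inr (Or.inr ⟨trivial, rfl⟩), hvz⟩
        · exact ⟨v, Or.inr (Or.inl rfl), hvz⟩
      · have : add2 (SS l K x p f fs H i) w u1 True =
            insert w (insert u1 (SS l K x p f fs H i)) := by
          ext c; simp [add2]; tauto
        rwa [this]
    · have hy12 := link_of_solSet_eq h hu1r1 hy1r hly1
      refine St_ext (b := True) hDn P h8 hyD hu1D hyu1 hne1 hly hcy
        (fun _ => ⟨hfD, hu2D, hfu2, hne2, hlf, hcf, fun h => hyf (kE_symm h)⟩) (r := r2) ?_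
        ⟨y1, hy12.2, hly1⟩ ?_ ?_ ?_
      · have : add2 (VV K p fs H i) u1 u2 True = VV K p fs H i ∪ {u1} ∪ {u2} := by
          ext c; simp [add2]; tauto
        rwa [this]
      · rintro v (hv | rfl | ⟨-, rfl⟩)
        · exact hnl1 v hv
        · exact live_nolink hL2 m1 m1
        · exact live_nolink hL2 m1 m2
      · intro z hz hlz
        obtain ⟨v, rfl | rfl, hvz⟩ := hcov8 z hz hlz
        · exact ⟨v, Or.inr (Or.inl rfl), hvz⟩
        · exact ⟨v, Or.inr (Or.inr ⟨trivial, rfl⟩), hvz⟩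
      · have : add2 (SS l K x p f fs H i) u1 u2 True =
            insert u2 (insert u1 (SS l K x p f fs H i)) := by
          ext c; simp [add2]; tauto
        rwa [this]
  · push Not at hsec
    refine St_ext (b := False) (ff := y) (gg := y) hDn P h8 hyD hu1D hyu1 hne1 hly hcy
        (fun h => h.elim) (r := r1) ?_ ⟨y1, hy1r, hly1⟩ ?_ ?_ ?_
    · rw [add2_false]; exact hr1
    · rintro v (hv | rfl | ⟨h, -⟩)
      · exact hnl1 v hv
      · exact live_nolink hL1 (Or.inl rfl) (Or.inl rfl)
      · exact h.elim
    · intro z hz hlz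
      by_cases hyz : keyEq l y z
      · exact ⟨u1, Or.inr (Or.inl rfl), kE_trans (kE_symm hyu1) hyz⟩
      · obtain ⟨v, hv, hvz⟩ := hsec z hz hlz hyz
        exact ⟨v, Or.inl hv, hvz⟩
    · rw [add2_false, Set.union_singleton]; exact hL1

theorem repair_exists (hD : D.Finite) : ∃ r, Repair l D r := by
  have hfin : {S | S ⊆ D ∧ Consistent l S}.Finite := hD.finite_subsets.subset fun S hS => hS.1
  obtain ⟨m, -, hm⟩ := hfin.exists_le_maximal (a := ∅)
    ⟨Set.empty_subset _, fun a ha => ha.elim⟩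
  exact ⟨m, hm.prop.1, hm.prop.2, fun s hms hsD hs =>
    (hm.le_of_ge ⟨hsD, hs⟩ hms).antisymm hms⟩

theorem K_exists (hl : l ≤ n) (hD : D.Finite) (hk : l ^ l + 1 ≤ k) (h0 : Live l k q D ∅)
    (a : Fin n → Elem) : ∃ K, Live l k q D K ∧ K.ncard ≤ l ^ l ∧
      (∀ c ∈ K, keySet l c ⊆ keySet l a) ∧
      ∀ c ∈ D, keySet l c ⊆ keySet l a → ∃ v ∈ K, keyEq l v c := by
  have hfin : {S | Live l k q D S ∧ ∀ c ∈ S, keySet l c ⊆ keySet l a}.Finite :=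
    hD.finite_subsets.subset fun S hS => hS.1.1.1
  obtain ⟨K, -, hm⟩ := hfin.exists_le_maximal (a := ∅) ⟨h0, fun a ha => ha.elim⟩
  have hL : Live l k q D K := hm.prop.1
  have hc : K.ncard ≤ l ^ l := by
    rw [Set.ncard_eq_toFinset_card K hL.1.2.1]
    refine count_le hl _ id a ?_ ?_
    · intro j hj
      exact hm.prop.2 j (by simpa using hj)
    · intro j hj j' hj' h
      exact hL.1.2.2.2 j (by simpa using hj) j' (by simpa using hj') h
  refine ⟨K, hL, hc, hm.prop.2, fun c hcD hca => ?_⟩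
  by_contra hcon
  push Not at hcon
  obtain ⟨u, -, hcu, hLu⟩ := live_extend hL hcD hcon (by omega)
  have hle : insert u K ≤ K := hm.le_of_ge ⟨hLu, by
    rintro c' (rfl | h)
    · rw [← kS_eq hcu]; exact hca
    · exact hm.prop.2 c' h⟩ (Set.subset_insert _ _)
  exact hcon u (hle (Set.mem_insert _ _)) (kE_symm hcu)

theorem complete (hq : TwoWayDet l q) (hl : l ≤ n) (hD : D.Finite)
    (hnt : ¬ ContainsTripath l q D) (hk : 5 * l ^ l + 3 ≤ k) (hcert : Certain l q D) :
    ∅ ∈ Delta l k q D := by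
  by_contra hcon
  have h0 : Live l k q D ∅ :=
    ⟨⟨Set.empty_subset _, Set.finite_empty, by simp, fun a ha => ha.elim⟩, hcon⟩
  obtain ⟨r, hr⟩ := repair_exists (l := l) hD
  obtain ⟨r0, hr0, -⟩ := min_below (q := q) hD hr (Set.empty_subset r)
  obtain ⟨a, b, har, hbr, hab⟩ := hcert r0 hr0.1
  have haD := hr0.1.1 har
  have hDn : D.Nonempty := ⟨a, haD⟩
  obtain ⟨K, hLK, hKc, hKa, hKcov⟩ := K_exists hl hD (by omega) h0 a
  have hKD : K ⊆ D := hLK.1.1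
  obtain ⟨r1, hr1, hact⟩ := min_step hD hr0 (W := K) hKD hLK.1.2.2.2 (fun v hv => hv.elim)
  rw [Set.empty_union] at hr1
  have hact' : ∃ w ∈ K, ∃ y ∈ r1, link q w y := by
    rcases hact with h | h
    · exact h
    · obtain ⟨h1, h2⟩ := link_of_solSet_eq h har hbr (Or.inl hab)
      obtain ⟨v, hv, hva⟩ := hKcov a haD subset_rfl
      have := hr1.1.2.1 v (hr1.2.1 hv) a h1 hva
      exact ⟨a, this ▸ hv, b, h2, Or.inl hab⟩
  obtain ⟨u0, hu0, y, hyr, hly⟩ := hact'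
  have hu0D := hKD hu0
  have hyD := hr1.1.1 hyr
  have hcy : ∀ v ∈ K, ¬ keyEq l v y := by
    intro v hv h
    have := hr1.1.2.1 v (hr1.2.1 hv) y hyr h
    exact live_nolink hLK hu0 (this ▸ hv) hly
  obtain ⟨p0, hp0D, hyp, hL0⟩ := live_extend hLK hyD hcy (by omega)
  have hne : y ≠ p0 := by
    rintro rfl
    exact live_nolink hL0 (Or.inr hu0) (Or.inl rfl) hly
  obtain ⟨r2, hr2, hact2⟩ := min_step hD hr1 (W := {p0}) (by simpa using hp0D)
    (by rintro a rfl b rfl _; rfl)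
    (by rintro v hv w rfl h; exact absurd (kE_symm (kE_trans hyp h)) (hcy v hv))
  have hact2' : ∃ z ∈ r2, link q p0 z := by
    rcases hact2 with ⟨w, rfl, h⟩ | h
    · exact h
    · have := link_of_solSet_eq h (hr1.2.1 hu0) hyr hly
      exact absurd (hr2.1.2.1 y this.2 p0 (hr2.2.1 (Or.inr rfl)) hyp) hne
  have hV : VV K (fun _ => p0) (fun _ => p0) ∅ 0 = K ∪ {p0} := by
    ext c
    simp [VV]
    tauto
  have hS0 : St l k q D K u0 0 := by
    refine ⟨fun _ => y, fun _ => p0, fun _ => p0, fun _ => p0, ∅, r2, ?_, ?_, hact2', ?_, ?_, ?_⟩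
    · exact
      { xD := fun _ _ => hyD
        pD := fun _ _ => hp0D
        xp := fun _ _ => hyp
        xne := fun _ _ => hne
        l0 := hly
        lx := fun t ht => by omega
        Hlt := fun j hj => hj.elim
        fD := fun j hj => hj.elim
        fsD := fun j hj => hj.elim
        ffs := fun j hj => hj.elim
        fne := fun j hj => hj.elim
        lf := fun j hj => hj.elim
        dxx := fun s t h h' => by omega
        dfx := fun j hj => hj.elim
        dff := fun j hj => hj.elim
        dKx := fun _ _ => hcy
        dKf := fun j hj => hj.elim }
    · rw [hV]; exact hr2
    · rw [hV]
      rintro v (hv | rfl)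
      · exact live_nolink hL0 (Or.inl rfl) (Or.inr hv)
      · exact live_nolink hL0 (Or.inl rfl) (Or.inl rfl)
    · intro j hj; omega
    · refine live_mono hDn hL0 ?_
      rintro c (h | rfl | ⟨j, hj, -⟩)
      · exact Or.inr h
      · exact Or.inl rfl
      · exact hj.elim
  have hall : ∀ i, St l k q D K u0 i := by
    intro i
    induction i with
    | zero => exact hS0
    | succ i ih =>
      exact St_step hq hl hD hnt hu0 hu0D
        (fun c hc h => hKcov c hc (h.trans (hKa u0 hu0))) hLK.1.2.1 hKc hk ih
  obtain ⟨x, p, f, fs, H, r, P, -⟩ := hall D.ncard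
  classical
  have hcard : (Finset.range (D.ncard + 1)).card ≤ hD.toFinset.card := by
    refine Finset.card_le_card_of_injOn x ?_ ?_
    · intro t ht
      simp only [Finset.coe_range, Set.mem_Iio] at ht
      simpa using P.xD t (by omega)
    · intro s hs t ht hst
      simp only [Finset.coe_range, Set.mem_Iio] at hs ht
      rcases lt_trichotomy s t with h | h | h
      · exact absurd (hst ▸ kE_refl _) (P.dxx s t h (by omega))
      · exact h
      · exact absurd (hst ▸ kE_refl _) (P.dxx t s h (by omega))
  rw [Finset.card_range, ← Set.ncard_eq_toFinset_card D hD] at hcard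
  omega

theorem arith (m : ℕ) (hm : 1 ≤ m) : 5 * m + 3 ≤ 2 ^ (2 * m + 1) + m - 1 := by
  have : 4 * m + 4 ≤ 2 ^ (2 * m + 1) := by
    induction m, hm using Nat.le_induction with
    | base => norm_num
    | succ m hm ih =>
      have : 2 ^ (2 * (m + 1) + 1) = 4 * 2 ^ (2 * m + 1) := by ring
      omega
  omega

end Aux

end CQA

/-- for a 2way-determined query and a database containing no tripath,
certainty coincides with the greedy fixpoint algorithm for `k = 2^(2κ+1) + κ - 1`,
`κ = l^l`. -/
theorem no_tripath_certain_eq_delta (n l : ℕ) (hn : 1 ≤ n) (hl : l ≤ n)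
    (Elem Var : Type) [Countable Elem] [Infinite Elem] [Countable Var] [Infinite Var]
    (q : CQA.Query n Var) (hq : CQA.TwoWayDet l q)
    (D : Set (Fin n → Elem)) (hD : D.Finite) (hnt : ¬ CQA.ContainsTripath l q D) :
    CQA.Certain l q D ↔
      ∅ ∈ CQA.Delta l (2 ^ (2 * l ^ l + 1) + l ^ l - 1) q D := by
  have hκ : 1 ≤ l ^ l := by
    rcases Nat.eq_zero_or_pos l with rfl | h
    · simp
    · exact Nat.one_le_pow _ _ h
  exact ⟨CQA.complete hq hl hD hnt (CQA.arith _ hκ), CQA.sound⟩
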